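/- Let γ = (ξ,η) ∈ 𝒢, let D, T ∈ ℕ* with 3 ≤ D ≤ T ≤ C(⌊D/3⌋+1, 2), and let α ∈ ℂ³ with ‖α‖ = 1. Then for any Q ∈ I^{(γ,T)}_T one has |Q(α)| ≤ c₃(γ)^{2T}·T^{6T·log(T)}·𝓛(Q)·|I^{(γ,T)}_D|_α, where c₃(γ) = (2+|ξ|+|η|⁻¹)·max{1,|ξ|,|η|}. -/

import Mathlib

open MvPolynomial

/-- The derivation `𝒟 = X₀·∂/∂X₁ + X₂·∂/∂X₂` of `ℂ[X₀,X₁,X₂]`. -/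
noncomputable def DD : MvPolynomial (Fin 3) ℂ → MvPolynomial (Fin 3) ℂ :=
  fun P => X 0 * pderiv 1 P + X 2 * pderiv 2 P

/-- The norm of a polynomial: the max of the absolute values of its coefficients. -/
noncomputable def pnorm (P : MvPolynomial (Fin 3) ℂ) : ℝ :=
  ((P.support.sup fun v => ‖P.coeff v‖₊ : NNReal) : ℝ)

/-- The length of a polynomial: the sum of the absolute values of its coefficients. -/
noncomputable def plen (P : MvPolynomial (Fin 3) ℂ) : ℝ :=
  ∑ v ∈ P.support, ‖P.coeff v‖

/-- The automorphism `τ_γ` of `ℂ[X₀,X₁,X₂]`, `τ_γ(P)(X₀,X₁,X₂) = P(X₀, ξX₀+X₁, ηX₂)`. -/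
noncomputable def tauG (ξ η : ℂ) : MvPolynomial (Fin 3) ℂ →ₐ[ℂ] MvPolynomial (Fin 3) ℂ :=
  aeval ![X 0, C ξ * X 0 + X 1, C η * X 2]

/-- The ideal `I^{(γ,T)}` generated by the homogeneous polynomials all of whose
derivatives `𝒟^i P`, `0 ≤ i < T`, vanish at `(1,ξ,η)`. -/
noncomputable def Igam (ξ η : ℂ) (T : ℕ) : Ideal (MvPolynomial (Fin 3) ℂ) :=
  Ideal.span {P | (∃ d, P.IsHomogeneous d) ∧ ∀ i < T, eval ![1, ξ, η] (DD^[i] P) = 0}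

noncomputable def c2c (ξ η : ℂ) : ℝ := max 1 (max ‖ξ‖ ‖η‖)

noncomputable def c3c (ξ η : ℂ) : ℝ := (2 + ‖ξ‖ + ‖η‖⁻¹) * c2c ξ η

noncomputable def c4c (ξ η : ℂ) : ℝ := 3 * c2c ξ η * Real.exp (2 * (c2c ξ η) ^ 2)

noncomputable def c5c (ξ η : ℂ) : ℝ := (2 * c2c ξ η + 3) * (c3c ξ η) ^ 2

/-- Projective distance from `α` (of norm 1) to the point `(1:ξ:η)`. -/
noncomputable def pdist (ξ η α₀ α₁ α₂ : ℂ) : ℝ :=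
  (c2c ξ η)⁻¹ * max ‖α₁ - α₀ * ξ‖ (max ‖α₂ - α₀ * η‖ ‖α₁ * η - α₂ * ξ‖)

/-- Distance from `α` to the analytic curve `A_γ = {(1:ξ+z:ηe^z)}`. -/
noncomputable def adist (ξ η α₀ α₁ α₂ : ℂ) : ℝ :=
  ‖α₂ / α₀ - η * Complex.exp (α₁ / α₀ - ξ)‖

/-- `|I^{(γ,T)}_D|_α = sup{|P(α)| : P ∈ I^{(γ,T)}_D, ‖P‖ ≤ 1}`. -/
noncomputable def Isup (ξ η : ℂ) (T D : ℕ) (α : Fin 3 → ℂ) : ℝ :=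
  sSup {x : ℝ | ∃ P : MvPolynomial (Fin 3) ℂ,
    P ∈ Igam ξ η T ∧ P.IsHomogeneous D ∧ pnorm P ≤ 1 ∧ x = ‖eval α P‖}

theorem MvPolynomial.IsHomogeneous.degree_eq_of_mem_support {P : MvPolynomial (Fin 3) ℂ} {k : ℕ}
    (hP : P.IsHomogeneous k) {v : Fin 3 →₀ ℕ} (hv : v ∈ P.support) : v.degree = k := by
  rw [Finsupp.degree_eq_weight_one]
  exact hP (MvPolynomial.mem_support_iff.mp hv)

section Length

variable (P Q : MvPolynomial (Fin 3) ℂ)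

theorem plen_eq_sum_of_support_subset {s : Finset (Fin 3 →₀ ℕ)} (h : P.support ⊆ s) :
    plen P = ∑ v ∈ s, ‖P.coeff v‖ := by
  refine Finset.sum_subset h fun v _ hv => ?_
  rw [MvPolynomial.notMem_support_iff.mp hv, norm_zero]

theorem plen_nonneg : 0 ≤ plen P := Finset.sum_nonneg fun _ _ => norm_nonneg _

theorem plen_zero : plen 0 = 0 := by simp [plen]

theorem plen_add_le : plen (P + Q) ≤ plen P + plen Q := by
  classical
  rw [plen_eq_sum_of_support_subset (P + Q) MvPolynomial.support_add,
    plen_eq_sum_of_support_subset P Finset.subset_union_left,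
    plen_eq_sum_of_support_subset Q Finset.subset_union_right, ← Finset.sum_add_distrib]
  exact Finset.sum_le_sum fun v _ => by rw [coeff_add]; exact norm_add_le _ _

theorem plen_neg : plen (-P) = plen P := by
  simp [plen, MvPolynomial.support_neg]

theorem plen_sub_le : plen (P - Q) ≤ plen P + plen Q := by
  rw [sub_eq_add_neg, ← plen_neg Q]
  exact plen_add_le _ _

theorem plen_sum_le {ι : Type*} (s : Finset ι) (f : ι → MvPolynomial (Fin 3) ℂ) :
    plen (∑ i ∈ s, f i) ≤ ∑ i ∈ s, plen (f i) :=
  Finset.le_sum_of_subadditive plen plen_zero.le plen_add_le s f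

theorem plen_monomial (v : Fin 3 →₀ ℕ) (a : ℂ) : plen (monomial v a) = ‖a‖ := by
  classical
  rw [plen_eq_sum_of_support_subset _ (MvPolynomial.support_monomial_subset (s := v) (a := a))]
  simp

theorem plen_monomial_mul_le (v : Fin 3 →₀ ℕ) (a : ℂ) :
    plen (monomial v a * Q) ≤ ‖a‖ * plen Q := by
  classical
  conv_lhs => rw [Q.as_sum, Finset.mul_sum]
  refine (plen_sum_le _ _).trans (le_of_eq ?_)
  rw [plen, Finset.mul_sum]
  refine Finset.sum_congr rfl fun w _ => ?_
  rw [monomial_mul, plen_monomial, norm_mul]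

theorem plen_mul_le : plen (P * Q) ≤ plen P * plen Q := by
  conv_lhs => rw [P.as_sum, Finset.sum_mul]
  refine (plen_sum_le _ _).trans ?_
  rw [plen, Finset.sum_mul]
  exact Finset.sum_le_sum fun v _ => plen_monomial_mul_le Q v _

theorem plen_C (a : ℂ) : plen (C a) = ‖a‖ := plen_monomial 0 a

theorem plen_X (i : Fin 3) : plen (X i) = 1 := by
  rw [X, plen_monomial, norm_one]

theorem plen_C_mul_le (a : ℂ) : plen (C a * P) ≤ ‖a‖ * plen P :=
  plen_monomial_mul_le P 0 a

theorem plen_X_mul_le (i : Fin 3) : plen (X i * P) ≤ plen P := by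
  simpa [plen_X] using plen_mul_le (X i) P

theorem plen_pow_le (n : ℕ) : plen (P ^ n) ≤ plen P ^ n := by
  induction n with
  | zero => rw [pow_zero, pow_zero, ← C_1, plen_C, norm_one]
  | succ n ih =>
    rw [pow_succ, pow_succ]
    exact (plen_mul_le _ _).trans (mul_le_mul_of_nonneg_right ih (plen_nonneg _))

theorem plen_X_pow_mul_le (i : Fin 3) (n : ℕ) : plen (X i ^ n * P) ≤ plen P := by
  refine (plen_mul_le _ _).trans ?_
  have := plen_pow_le (X i) n
  rw [plen_X, one_pow] at this
  simpa using mul_le_mul_of_nonneg_right this (plen_nonneg P)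

theorem pnorm_le_plen : pnorm P ≤ plen P := by
  have : P.support.sup (fun v => ‖P.coeff v‖₊) ≤ ∑ v ∈ P.support, ‖P.coeff v‖₊ :=
    Finset.sup_le fun v hv =>
      Finset.single_le_sum (f := fun v => ‖P.coeff v‖₊) (fun _ _ => zero_le) hv
  have h2 : pnorm P ≤ ((∑ v ∈ P.support, ‖P.coeff v‖₊ : NNReal) : ℝ) := this
  simpa [plen] using h2

theorem norm_coeff_le_pnorm (v : Fin 3 →₀ ℕ) : ‖P.coeff v‖ ≤ pnorm P := by
  by_cases hv : v ∈ P.support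
  · exact Finset.le_sup (f := fun v => ‖P.coeff v‖₊) hv
  · rw [MvPolynomial.notMem_support_iff.mp hv, norm_zero]
    exact NNReal.coe_nonneg _

theorem pnorm_C_mul_le (a : ℂ) : pnorm (C a * P) ≤ ‖a‖ * pnorm P := by
  have : (C a * P).support.sup (fun v => ‖(C a * P).coeff v‖₊) ≤
      ‖a‖₊ * P.support.sup (fun v => ‖P.coeff v‖₊) := by
    refine Finset.sup_le fun v _ => ?_
    rw [coeff_C_mul, nnnorm_mul]
    gcongr
    exact norm_coeff_le_pnorm P v
  exact this

variable {P}

theorem plen_le_of_isHomogeneous {D : ℕ} (hP : P.IsHomogeneous D) :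
    plen P ≤ (Finset.Iic (Finsupp.equivFunOnFinite.symm fun _ : Fin 3 => D)).card * pnorm P := by
  have hs : P.support ⊆ Finset.Iic (Finsupp.equivFunOnFinite.symm fun _ : Fin 3 => D) := by
    intro v hv
    rw [Finset.mem_Iic]
    intro i
    have h := hP.degree_eq_of_mem_support hv
    simpa [← h] using Finsupp.le_degree i v
  rw [plen_eq_sum_of_support_subset P hs, ← nsmul_eq_mul]
  exact Finset.sum_le_card_nsmul _ _ _ fun v _ => norm_coeff_le_pnorm P v

theorem norm_eval_le {k : ℕ} (hP : P.IsHomogeneous k) {β : Fin 3 → ℂ} {c : ℝ}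
    (hβ : ∀ i, ‖β i‖ ≤ c) : ‖eval β P‖ ≤ c ^ k * plen P := by
  rw [eval_eq', plen, Finset.mul_sum]
  refine norm_sum_le_of_le _ fun v hv => ?_
  have h := hP.degree_eq_of_mem_support hv
  rw [Finsupp.degree_eq_sum] at h
  rw [norm_mul, mul_comm, norm_prod, ← h, ← Finset.prod_pow_eq_pow_sum]
  gcongr with i
  rw [norm_pow]
  exact pow_le_pow_left₀ (norm_nonneg _) (hβ i) _

end Length

section Derivation

/-- `DD` as a bundled derivation. -/
noncomputable def der :
    Derivation ℂ (MvPolynomial (Fin 3) ℂ) (MvPolynomial (Fin 3) ℂ) :=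
  (X 0 : MvPolynomial (Fin 3) ℂ) • pderiv 1 + (X 2 : MvPolynomial (Fin 3) ℂ) • pderiv 2

theorem der_apply (P : MvPolynomial (Fin 3) ℂ) : der P = DD P := by
  simp [der, DD]

theorem der_X_zero : der (X 0) = 0 := by
  simp [der, pderiv_X]

theorem der_X_one : der (X 1) = X 0 := by
  simp [der, pderiv_X]

theorem der_X_two : der (X 2) = X 2 := by
  simp [der, pderiv_X]

theorem der_C_mul (a : ℂ) (P : MvPolynomial (Fin 3) ℂ) : der (C a * P) = C a * der P := by
  simp [Derivation.leibniz]

theorem der_X_zero_pow_mul (n : ℕ) (P : MvPolynomial (Fin 3) ℂ) :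
    der (X 0 ^ n * P) = X 0 ^ n * der P := by
  simp [Derivation.leibniz, Derivation.leibniz_pow, der_X_zero]

variable {P : MvPolynomial (Fin 3) ℂ} {k : ℕ}

theorem isHomogeneous_X_mul_pderiv (i j : Fin 3) (hP : P.IsHomogeneous k) :
    (X i * pderiv j P).IsHomogeneous k := by
  rcases k with _ | k
  · rw [totalDegree_eq_zero_iff_eq_C.mp (Nat.le_zero.mp hP.totalDegree_le)]
    simpa using isHomogeneous_zero _ _ _
  · have := (isHomogeneous_X ℂ i).mul (hP.pderiv (i := j))
    rwa [Nat.add_sub_cancel, add_comm] at this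

theorem isHomogeneous_der (hP : P.IsHomogeneous k) : (der P).IsHomogeneous k := by
  rw [der_apply]
  exact (isHomogeneous_X_mul_pderiv 0 1 hP).add (isHomogeneous_X_mul_pderiv 2 2 hP)

theorem plen_der_monomial_le (v : Fin 3 →₀ ℕ) (a : ℂ) :
    plen (der (monomial v a)) ≤ v.degree * ‖a‖ := by
  rw [der_apply, DD, pderiv_monomial, pderiv_monomial]
  refine (plen_add_le _ _).trans ((add_le_add (plen_X_mul_le _ _) (plen_X_mul_le _ _)).trans ?_)
  rw [plen_monomial, plen_monomial, norm_mul, norm_mul, Complex.norm_natCast,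
    Complex.norm_natCast, ← mul_add, mul_comm, Finsupp.degree_eq_sum, Fin.sum_univ_three]
  push_cast
  gcongr
  linarith [(Nat.cast_nonneg (v 0) : (0 : ℝ) ≤ v 0)]

theorem plen_der_le (hP : P.IsHomogeneous k) : plen (der P) ≤ k * plen P := by
  conv_lhs => rw [P.as_sum, map_sum]
  refine (plen_sum_le _ _).trans ?_
  rw [plen, Finset.mul_sum]
  refine Finset.sum_le_sum fun v hv => ?_
  have h := hP.degree_eq_of_mem_support hv
  rw [← h]
  exact plen_der_monomial_le v _

end Derivation

section NewtonOperators

variable (t : ℕ → ℂ)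

/-- The operator `∏_{i < j} (𝒟 - t i)`. -/
noncomputable def newtonOp : ℕ → MvPolynomial (Fin 3) ℂ →ₗ[ℂ] MvPolynomial (Fin 3) ℂ
  | 0 => LinearMap.id
  | j + 1 => (der.toLinearMap - t j • LinearMap.id) ∘ₗ newtonOp j

theorem newtonOp_zero (P : MvPolynomial (Fin 3) ℂ) : newtonOp t 0 P = P := rfl

theorem newtonOp_succ (j : ℕ) (P : MvPolynomial (Fin 3) ℂ) :
    newtonOp t (j + 1) P = der (newtonOp t j P) - C (t j) * newtonOp t j P := by
  simp [newtonOp, smul_eq_C_mul]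

theorem newtonOp_X_zero_pow_mul (n j : ℕ) (P : MvPolynomial (Fin 3) ℂ) :
    newtonOp t j (X 0 ^ n * P) = X 0 ^ n * newtonOp t j P := by
  induction j with
  | zero => rfl
  | succ j ih => rw [newtonOp_succ, newtonOp_succ, ih, der_X_zero_pow_mul]; ring

variable {t} {P : MvPolynomial (Fin 3) ℂ}

theorem isHomogeneous_newtonOp {k : ℕ} (hP : P.IsHomogeneous k) (j : ℕ) :
    (newtonOp t j P).IsHomogeneous k := by
  induction j with
  | zero => exact hP
  | succ j ih =>
    rw [newtonOp_succ]
    have := (isHomogeneous_C (Fin 3) (t j)).mul ih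
    rw [zero_add] at this
    exact (isHomogeneous_der ih).sub this

theorem plen_newtonOp_le {k : ℕ} {c : ℝ} (hP : P.IsHomogeneous k) {T : ℕ}
    (ht : ∀ i < T, ‖t i‖ ≤ c) (hc : 0 ≤ c) {j : ℕ} (hj : j ≤ T) :
    plen (newtonOp t j P) ≤ (k + c) ^ j * plen P := by
  induction j with
  | zero => simp [newtonOp_zero]
  | succ j ih =>
    have h := ih (by lia)
    rw [newtonOp_succ, pow_succ']
    calc plen (der (newtonOp t j P) - C (t j) * newtonOp t j P)
        ≤ k * plen (newtonOp t j P) + ‖t j‖ * plen (newtonOp t j P) :=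
          (plen_sub_le _ _).trans (add_le_add (plen_der_le (isHomogeneous_newtonOp hP j))
            (plen_C_mul_le _ _))
      _ ≤ (k + c) * plen (newtonOp t j P) := by
          rw [← add_mul]
          gcongr
          · exact plen_nonneg _
          · exact ht j (by lia)
      _ ≤ (k + c) * (k + c) ^ j * plen P := by
          rw [mul_assoc]
          gcongr

theorem DD_iterate_add (i : ℕ) (P Q : MvPolynomial (Fin 3) ℂ) :
    DD^[i] (P + Q) = DD^[i] P + DD^[i] Q := by
  have : DD = ⇑der.toLinearMap := funext fun P => (der_apply P).symm
  rw [this, ← Module.End.coe_pow, map_add]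

theorem DD_iterate_C_mul (i : ℕ) (a : ℂ) (P : MvPolynomial (Fin 3) ℂ) :
    DD^[i] (C a * P) = C a * DD^[i] P := by
  have : DD = ⇑der.toLinearMap := funext fun P => (der_apply P).symm
  rw [this, ← Module.End.coe_pow, ← smul_eq_C_mul, map_smul, smul_eq_C_mul]

variable {β : Fin 3 → ℂ} {T : ℕ}

theorem eval_DD_iterate_eq_zero (h : ∀ j < T, eval β (newtonOp t j P) = 0) (i : ℕ) :
    ∀ j, i + j < T → eval β (DD^[i] (newtonOp t j P)) = 0 := by
  induction i with
  | zero => exact fun j hj => h j (by lia)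
  | succ i ih =>
    intro j hj
    have e : DD (newtonOp t j P) = newtonOp t (j + 1) P + C (t j) * newtonOp t j P := by
      rw [newtonOp_succ, der_apply]; ring
    rw [Function.iterate_succ_apply, e, DD_iterate_add, DD_iterate_C_mul, map_add, map_mul,
      ih _ (by lia), ih _ (by lia)]
    simp

theorem eval_DD_iterate_newtonOp_eq_zero (h : ∀ i < T, eval β (DD^[i] P) = 0) (j : ℕ) :
    ∀ i, i + j < T → eval β (DD^[i] (newtonOp t j P)) = 0 := by
  induction j with
  | zero => exact fun i hi => h i (by lia)
  | succ j ih =>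
    intro i hi
    have e : newtonOp t (j + 1) P = DD (newtonOp t j P) + C (-t j) * newtonOp t j P := by
      rw [newtonOp_succ, der_apply, map_neg]; ring
    rw [e, DD_iterate_add, DD_iterate_C_mul, map_add, map_mul, ih _ (by lia),
      ← Function.iterate_succ_apply, ih _ (by lia)]
    simp

theorem eval_DD_iterate_mul_eq_zero (i : ℕ) :
    ∀ P : MvPolynomial (Fin 3) ℂ, (∀ j ≤ i, eval β (DD^[j] P) = 0) →
      ∀ A, eval β (DD^[i] (A * P)) = 0 := by
  induction i with
  | zero =>
    intro P h A
    have := h 0 le_rfl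
    simp_all
  | succ i ih =>
    intro P h A
    have e : DD (A * P) = A * DD P + DD A * P := by
      rw [← der_apply, ← der_apply, ← der_apply, Derivation.leibniz, smul_eq_mul, smul_eq_mul]
      ring
    rw [Function.iterate_succ_apply, e, DD_iterate_add, map_add,
      ih P (fun j hj => h j (by lia)),
      ih (DD P) (fun j hj => by rw [← Function.iterate_succ_apply]; exact h _ (by lia)), add_zero]

theorem eval_DD_iterate_of_mem_Igam {ξ η : ℂ} (hP : P ∈ Igam ξ η T) :
    ∀ i < T, eval ![1, ξ, η] (DD^[i] P) = 0 := by
  induction hP using Submodule.span_induction with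
  | mem P h => exact h.2
  | zero =>
    intro i _
    simpa using congrArg (eval ![1, ξ, η]) (DD_iterate_C_mul i 0 0)
  | add P Q _ _ hP hQ =>
    intro i hi
    rw [DD_iterate_add, map_add, hP i hi, hQ i hi, add_zero]
  | smul A P _ hP =>
    intro i hi
    exact eval_DD_iterate_mul_eq_zero i P (fun j hj => hP j (by lia)) A

theorem eval_newtonOp_of_mem_Igam {ξ η : ℂ} (hP : P ∈ Igam ξ η T) {j : ℕ} (hj : j < T) :
    eval ![1, ξ, η] (newtonOp t j P) = 0 :=
  eval_DD_iterate_newtonOp_eq_zero (eval_DD_iterate_of_mem_Igam hP) j 0 (by lia)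

theorem mem_Igam_of_newtonOp {ξ η : ℂ} {k : ℕ} (hP : P.IsHomogeneous k)
    (h : ∀ j < T, eval ![1, ξ, η] (newtonOp t j P) = 0) : P ∈ Igam ξ η T :=
  Ideal.subset_span ⟨⟨k, hP⟩, fun i hi => eval_DD_iterate_eq_zero h i 0 (by lia)⟩

end NewtonOperators

section Nodes

theorem exists_triangular_blocks : ∃ s : ℕ → ℕ, Monotone s ∧
    (∀ i n, s (i + n) = s i → n ≤ s i) ∧ ∀ N i, i < (N + 1).choose 2 → s i < N := by
  have hex : ∀ i : ℕ, ∃ m : ℕ, (m + 1).choose 2 ≤ i ∧ i < (m + 2).choose 2 := by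
    intro i
    induction i with
    | zero => exact ⟨0, by decide, by decide⟩
    | succ i ih =>
      obtain ⟨m, h1, h2⟩ := ih
      by_cases h : i + 1 < (m + 2).choose 2
      · exact ⟨m, by lia, h⟩
      · have : (m + 3).choose 2 = (m + 2).choose 1 + (m + 2).choose 2 := rfl
        rw [Nat.choose_one_right] at this
        exact ⟨m + 1, by lia, by lia⟩
  choose s hs using hex
  have key : ∀ i N, i < (N + 1).choose 2 → s i < N := by
    intro i N h
    by_contra! hc
    have := Nat.choose_le_choose 2 (Nat.succ_le_succ hc)
    have := (hs i).1
    lia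
  refine ⟨s, fun i j hij => ?_, fun i n h => ?_, fun N i => key i N⟩
  · exact Nat.lt_succ_iff.mp (key i (s j + 1) (hij.trans_lt (hs j).2))
  · have h1 := (hs i).1
    have h2 := (hs (i + n)).2
    have : (s i + 2).choose 2 = (s i + 1).choose 1 + (s i + 1).choose 2 := rfl
    rw [h, this, Nat.choose_one_right] at h2
    lia

end Nodes

section HermiteBasis

variable (ξ η : ℂ) (K : ℕ)

/-- The form of degree `K` (for `n ≤ m ≤ K`) whose restriction to the curve
`(1 : ξ + z : η e ^ z)` is `z ^ n / n! * e ^ ((K - m) z)`. -/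
noncomputable def expMonomial (m n : ℕ) : MvPolynomial (Fin 3) ℂ :=
  C (n.factorial : ℂ)⁻¹ *
    (X 0 ^ (m - n) * ((X 1 - C ξ * X 0) ^ n * (C η⁻¹ * X 2) ^ (K - m)))

variable {K}

theorem isHomogeneous_expMonomial {m n : ℕ} (hn : n ≤ m) (hm : m ≤ K) :
    (expMonomial ξ η K m n).IsHomogeneous K := by
  have h1 : ((X 1 - C ξ * X 0) ^ n : MvPolynomial (Fin 3) ℂ).IsHomogeneous n := by
    have := ((isHomogeneous_X ℂ (1 : Fin 3)).sub
      (by simpa using (isHomogeneous_C (Fin 3) ξ).mul (isHomogeneous_X ℂ 0))).pow n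
    rwa [one_mul] at this
  have h2 : ((C η⁻¹ * X 2) ^ (K - m) : MvPolynomial (Fin 3) ℂ).IsHomogeneous (K - m) := by
    have := ((isHomogeneous_C (Fin 3) η⁻¹).mul (isHomogeneous_X ℂ 2)).pow (K - m)
    rwa [zero_add, one_mul] at this
  have := (isHomogeneous_C (Fin 3) (n.factorial : ℂ)⁻¹).mul
    ((isHomogeneous_X_pow (R := ℂ) (0 : Fin 3) (m - n)).mul (h1.mul h2))
  rwa [show 0 + (m - n + (n + (K - m))) = K by lia] at this

theorem plen_expMonomial_le {m n : ℕ} (hn : n ≤ m) (hm : m ≤ K) :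
    plen (expMonomial ξ η K m n) ≤ (2 + ‖ξ‖ + ‖η‖⁻¹) ^ K := by
  have hη : 0 ≤ ‖η‖⁻¹ := inv_nonneg.mpr (norm_nonneg _)
  have hξ : 0 ≤ ‖ξ‖ := norm_nonneg _
  have h1 : plen (X 1 - C ξ * X 0) ≤ 2 + ‖ξ‖ + ‖η‖⁻¹ := by
    have := (plen_sub_le (X 1) (C ξ * X 0)).trans
      (add_le_add_right (plen_C_mul_le (X 0) ξ) _)
    rw [plen_X, plen_X] at this
    linarith
  have h2 : plen (C η⁻¹ * X 2) ≤ 2 + ‖ξ‖ + ‖η‖⁻¹ := by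
    have := plen_C_mul_le (X 2) η⁻¹
    rw [plen_X, norm_inv] at this
    linarith
  have hf : ‖(n.factorial : ℂ)⁻¹‖ ≤ 1 := by
    rw [norm_inv, Complex.norm_natCast]
    exact inv_le_one_of_one_le₀ (by exact_mod_cast n.factorial_pos)
  calc plen (expMonomial ξ η K m n)
      ≤ 1 * plen ((X 1 - C ξ * X 0) ^ n * (C η⁻¹ * X 2) ^ (K - m)) := by
        refine (plen_C_mul_le _ _).trans (mul_le_mul hf (plen_X_pow_mul_le _ _ _)
          (plen_nonneg _) zero_le_one)
    _ ≤ (2 + ‖ξ‖ + ‖η‖⁻¹) ^ n * (2 + ‖ξ‖ + ‖η‖⁻¹) ^ (K - m) := by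
        rw [one_mul]
        refine (plen_mul_le _ _).trans (mul_le_mul ?_ ?_ (plen_nonneg _) (by positivity))
        · exact (plen_pow_le _ _).trans (pow_le_pow_left₀ (plen_nonneg _) h1 _)
        · exact (plen_pow_le _ _).trans (pow_le_pow_left₀ (plen_nonneg _) h2 _)
    _ ≤ (2 + ‖ξ‖ + ‖η‖⁻¹) ^ K := by
        rw [← pow_add]
        exact pow_le_pow_right₀ (by linarith) (by lia)

theorem der_pow_X_two (m : ℕ) :
    der ((C η⁻¹ * X 2) ^ m) = C (m : ℂ) * (C η⁻¹ * X 2) ^ m := by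
  induction m with
  | zero => simp
  | succ m ih =>
    rw [pow_succ, Derivation.leibniz, ih, der_C_mul, der_X_two]
    simp only [smul_eq_mul, Nat.cast_succ, map_add, map_one]
    ring

theorem der_pow_X_one (n : ℕ) :
    der ((X 1 - C ξ * X 0) ^ (n + 1)) =
      C ((n : ℂ) + 1) * (X 0 * (X 1 - C ξ * X 0) ^ n) := by
  rw [Derivation.leibniz_pow, map_sub, der_C_mul, der_X_zero, der_X_one]
  simp only [smul_eq_mul, nsmul_eq_mul, map_add, map_one, map_natCast, Nat.add_sub_cancel]
  push_cast
  ring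

theorem der_expMonomial_zero {m : ℕ} (hm : m ≤ K) :
    der (expMonomial ξ η K m 0) - C ((K : ℂ) - m) * expMonomial ξ η K m 0 = 0 := by
  rw [expMonomial, der_C_mul, der_X_zero_pow_mul, pow_zero, one_mul, der_pow_X_two,
    Nat.cast_sub hm]
  ring

theorem der_expMonomial_succ {m n : ℕ} (hn : n + 1 ≤ m) (hm : m ≤ K) :
    der (expMonomial ξ η K m (n + 1)) - C ((K : ℂ) - m) * expMonomial ξ η K m (n + 1) =
      expMonomial ξ η K m n := by
  have hf : ((n + 1).factorial : ℂ)⁻¹ * ((n : ℂ) + 1) = (n.factorial : ℂ)⁻¹ := by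
    rw [Nat.factorial_succ]
    push_cast
    have : (n : ℂ) + 1 ≠ 0 := by exact_mod_cast n.succ_ne_zero
    field_simp
  rw [expMonomial, expMonomial, der_C_mul, der_X_zero_pow_mul, Derivation.leibniz,
    der_pow_X_one, der_pow_X_two, ← hf, Nat.cast_sub hm, show m - n = m - (n + 1) + 1 by lia,
    pow_succ, C_mul]
  simp only [smul_eq_mul]
  ring

variable {η}

theorem eval_expMonomial (hη : η ≠ 0) (m n : ℕ) :
    eval ![1, ξ, η] (expMonomial ξ η K m n) = if n = 0 then 1 else 0 := by
  rcases n with _ | n <;> simp [expMonomial, hη]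

variable (η K) (s : ℕ → ℕ)

/-- The form of degree `K` whose restriction to the curve `(1 : ξ + z : η e ^ z)` is the divided
difference of `x ↦ e ^ (x z)` at the `n` nodes `K - s i, …, K - s (i + n - 1)`. -/
noncomputable def dividedExp : ℕ → ℕ → MvPolynomial (Fin 3) ℂ
  | 0, _ => 0
  | n + 1, i =>
    if s (i + n) = s i then expMonomial ξ η K (s i) n
    else C ((s i : ℂ) - s (i + n))⁻¹ * (dividedExp n (i + 1) - dividedExp n i)

theorem dividedExp_zero (i : ℕ) : dividedExp ξ η K s 0 i = 0 := by rw [dividedExp]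

variable {s} {T : ℕ}

theorem dividedExp_of_eq {n i : ℕ} (h : s (i + n) = s i) :
    dividedExp ξ η K s (n + 1) i = expMonomial ξ η K (s i) n := by
  rw [dividedExp, if_pos h]

theorem dividedExp_of_ne {n i : ℕ} (h : s (i + n) ≠ s i) :
    dividedExp ξ η K s (n + 1) i =
      C ((s i : ℂ) - s (i + n))⁻¹ * (dividedExp ξ η K s n (i + 1) - dividedExp ξ η K s n i) := by
  rw [dividedExp, if_neg h]

variable {η K}

theorem eval_dividedExp (hη : η ≠ 0) (n : ℕ) : ∀ i,
    eval ![1, ξ, η] (dividedExp ξ η K s (n + 1) i) = if n = 0 then 1 else 0 := by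
  induction n with
  | zero => exact fun i => by rw [dividedExp_of_eq ξ η K (by simp), eval_expMonomial ξ hη]
  | succ n ih =>
    intro i
    by_cases h : s (i + (n + 1)) = s i
    · rw [dividedExp_of_eq ξ η K h, eval_expMonomial ξ hη]
    · rw [dividedExp_of_ne ξ η K h, map_mul, map_sub, ih, ih]
      simp

variable (η) (hblock : ∀ i n, s (i + n) = s i → n ≤ s i) (hK : ∀ i < T, s i ≤ K)

include hblock hK

theorem isHomogeneous_dividedExp (n : ℕ) :
    ∀ i, i + n ≤ T → (dividedExp ξ η K s n i).IsHomogeneous K := by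
  induction n with
  | zero => exact fun i _ => by rw [dividedExp_zero]; exact isHomogeneous_zero _ _ _
  | succ n ih =>
    intro i hi
    by_cases h : s (i + n) = s i
    · rw [dividedExp_of_eq ξ η K h]
      exact isHomogeneous_expMonomial ξ η (hblock i n h) (hK i (by lia))
    · rw [dividedExp_of_ne ξ η K h]
      simpa using (isHomogeneous_C (Fin 3) _).mul ((ih (i + 1) (by lia)).sub (ih i (by lia)))

theorem plen_dividedExp_le (n : ℕ) :
    ∀ i, i + n ≤ T → plen (dividedExp ξ η K s n i) ≤ 2 ^ n * (2 + ‖ξ‖ + ‖η‖⁻¹) ^ K := by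
  induction n with
  | zero => exact fun i _ => by rw [dividedExp_zero, plen_zero]; positivity
  | succ n ih =>
    intro i hi
    by_cases h : s (i + n) = s i
    · rw [dividedExp_of_eq ξ η K h]
      refine (plen_expMonomial_le ξ η (hblock i n h) (hK i (by lia))).trans ?_
      exact le_mul_of_one_le_left (by positivity) (one_le_pow₀ one_le_two)
    · have hd : ‖((s i : ℂ) - s (i + n))⁻¹‖ ≤ 1 := by
        rw [norm_inv]
        refine inv_le_one_of_one_le₀ ?_
        have : ((s i : ℂ) - s (i + n)) = (((s i : ℤ) - s (i + n) : ℤ) : ℂ) := by push_cast; ring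
        rw [this, Complex.norm_intCast]
        exact_mod_cast Int.one_le_abs (by lia : (s i : ℤ) - s (i + n) ≠ 0)
      rw [dividedExp_of_ne ξ η K h]
      calc _ ≤ 1 * (plen (dividedExp ξ η K s n (i + 1)) + plen (dividedExp ξ η K s n i)) :=
            (plen_C_mul_le _ _).trans
              (mul_le_mul hd (plen_sub_le _ _) (plen_nonneg _) zero_le_one)
        _ ≤ 1 * (2 ^ n * (2 + ‖ξ‖ + ‖η‖⁻¹) ^ K + 2 ^ n * (2 + ‖ξ‖ + ‖η‖⁻¹) ^ K) := by
            gcongr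
            · exact ih _ (by lia)
            · exact ih _ (by lia)
        _ = _ := by ring

variable (hmono : Monotone s)

include hmono

theorem der_dividedExp (n : ℕ) : ∀ i, i + n < T →
    der (dividedExp ξ η K s (n + 1) i) - C ((K : ℂ) - s i) * dividedExp ξ η K s (n + 1) i =
        dividedExp ξ η K s n (i + 1) ∧
      der (dividedExp ξ η K s (n + 1) i) -
          C ((K : ℂ) - s (i + n)) * dividedExp ξ η K s (n + 1) i =
        dividedExp ξ η K s n i := by
  induction n with
  | zero =>
    intro i hi
    rw [dividedExp_of_eq ξ η K (by simp), dividedExp_zero, dividedExp_zero, add_zero,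
      der_expMonomial_zero ξ η (hK i (by lia))]
    simp
  | succ n ih =>
    intro i hi
    by_cases h : s (i + (n + 1)) = s i
    · have h1 : s (i + 1) = s i :=
        le_antisymm ((hmono (by lia)).trans h.le) (hmono (by lia))
      have h2 : s (i + n) = s i :=
        le_antisymm ((hmono (by lia)).trans h.le) (hmono (by lia))
      have h3 : s (i + 1 + n) = s (i + 1) := by rw [h1, ← h]; congr 1; ring
      rw [h, dividedExp_of_eq ξ η K h, dividedExp_of_eq ξ η K h2, dividedExp_of_eq ξ η K h3, h1,
        der_expMonomial_succ ξ η (hblock i _ h) (hK i (by lia))]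
      simp
    · have hne : (s i : ℂ) - s (i + (n + 1)) ≠ 0 := by
        rw [sub_ne_zero]
        exact_mod_cast Ne.symm h
      have hC : C ((s i : ℂ) - s (i + (n + 1)))⁻¹ * C ((s i : ℂ) - s (i + (n + 1))) =
          (1 : MvPolynomial (Fin 3) ℂ) := by
        rw [← C_mul, inv_mul_cancel₀ hne, C_1]
      have e1 := (ih (i + 1) (by lia)).2
      have e2 := (ih i (by lia)).1
      rw [show i + 1 + n = i + (n + 1) by ring] at e1
      rw [dividedExp_of_ne ξ η K h, der_C_mul, map_sub]
      simp only [map_sub] at e1 e2 hC ⊢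
      set G := dividedExp ξ η K s (n + 1) (i + 1)
      set H := dividedExp ξ η K s (n + 1) i
      constructor
      · linear_combination C ((s i : ℂ) - s (i + (n + 1)))⁻¹ * (e1 - e2) + G * hC
      · linear_combination C ((s i : ℂ) - s (i + (n + 1)))⁻¹ * (e1 - e2) + H * hC

theorem newtonOp_dividedExp {k : ℕ} (hk : k ≤ T) (j : ℕ) :
    newtonOp (fun i => (K : ℂ) - s i) j (dividedExp ξ η K s k 0) =
      dividedExp ξ η K s (k - j) j := by
  induction j with
  | zero => rfl
  | succ j ih =>
    rw [newtonOp_succ, ih]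
    rcases hn : k - j with _ | n
    · rw [dividedExp_zero, show k - (j + 1) = 0 by lia, dividedExp_zero]
      simp
    · rw [(der_dividedExp ξ η hblock hK hmono n j (by lia)).1, show k - (j + 1) = n by lia]

theorem eval_newtonOp_dividedExp (hη : η ≠ 0) {k : ℕ} (hk : k < T) (j : ℕ) :
    eval ![1, ξ, η] (newtonOp (fun i => (K : ℂ) - s i) j (dividedExp ξ η K s (k + 1) 0)) =
      if k = j then 1 else 0 := by
  rw [newtonOp_dividedExp ξ η hblock hK hmono hk]
  rcases lt_or_ge k j with h | h
  · rw [show k + 1 - j = 0 by lia, dividedExp_zero, map_zero, if_neg h.ne]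
  · rw [show k + 1 - j = k - j + 1 by lia, eval_dividedExp ξ hη]
    congr 1
    exact propext (by lia)

end HermiteBasis

section Reduction

variable (ξ η : ℂ) (K : ℕ) (s : ℕ → ℕ) (T : ℕ)

/-- The linear map sending a form `P` to the form of degree `K` which has the same first `T`
derivatives along `𝒟` at `(1, ξ, η)`. -/
noncomputable def jetReduction : MvPolynomial (Fin 3) ℂ →ₗ[ℂ] MvPolynomial (Fin 3) ℂ :=
  ∑ j ∈ Finset.range T,
    ((aeval ![1, ξ, η]).toLinearMap ∘ₗ newtonOp (fun i => (K : ℂ) - s i) j).smulRight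
      (dividedExp ξ η K s (j + 1) 0)

theorem jetReduction_apply (P : MvPolynomial (Fin 3) ℂ) :
    jetReduction ξ η K s T P = ∑ j ∈ Finset.range T,
      C (eval ![1, ξ, η] (newtonOp (fun i => (K : ℂ) - s i) j P)) *
        dividedExp ξ η K s (j + 1) 0 := by
  simp [jetReduction, LinearMap.sum_apply, smul_eq_C_mul, aeval_eq_eval]

variable {K s T} (hblock : ∀ i n, s (i + n) = s i → n ≤ s i) (hK : ∀ i < T, s i ≤ K)

theorem jetReduction_of_mem_Igam {P : MvPolynomial (Fin 3) ℂ} (hP : P ∈ Igam ξ η T) :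
    jetReduction ξ η K s T P = 0 := by
  rw [jetReduction_apply]
  refine Finset.sum_eq_zero fun j hj => ?_
  rw [eval_newtonOp_of_mem_Igam hP (Finset.mem_range.mp hj), map_zero, zero_mul]

include hblock hK

theorem isHomogeneous_jetReduction (P : MvPolynomial (Fin 3) ℂ) :
    (jetReduction ξ η K s T P).IsHomogeneous K := by
  rw [jetReduction_apply]
  refine IsHomogeneous.sum _ _ _ fun j hj => ?_
  have := (isHomogeneous_C (Fin 3)
    (eval ![1, ξ, η] (newtonOp (fun i => (K : ℂ) - s i) j P))).mul
    (isHomogeneous_dividedExp ξ η hblock hK (j + 1) 0 (by have := Finset.mem_range.mp hj; lia))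
  rwa [zero_add] at this

theorem plen_jetReduction_le (hKT : K ≤ T) {k : ℕ} (hk : k ≤ T)
    {P : MvPolynomial (Fin 3) ℂ} (hP : P.IsHomogeneous k) :
    plen (jetReduction ξ η K s T P) ≤ T * (4 * T) ^ T * c3c ξ η ^ T * plen P := by
  rcases Nat.eq_zero_or_pos T with rfl | hT
  · rw [jetReduction_apply]; simp [plen_zero]
  have hT1 : (1 : ℝ) ≤ T := by exact_mod_cast hT
  have hη : 0 ≤ ‖η‖⁻¹ := inv_nonneg.mpr (norm_nonneg _)
  have hξ : 0 ≤ ‖ξ‖ := norm_nonneg _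
  have hc2 : 1 ≤ c2c ξ η := le_max_left _ _
  have hβ : ∀ i, ‖(![1, ξ, η] : Fin 3 → ℂ) i‖ ≤ c2c ξ η := by
    intro i
    fin_cases i <;> simp [c2c]
  have ht : ∀ i < T, ‖(K : ℂ) - s i‖ ≤ T := by
    intro i hi
    rw [← Nat.cast_sub (hK i hi), Complex.norm_natCast]
    exact_mod_cast (Nat.sub_le _ _).trans hKT
  have hterm : ∀ j ∈ Finset.range T,
      plen (C (eval ![1, ξ, η] (newtonOp (fun i => (K : ℂ) - s i) j P)) *
        dividedExp ξ η K s (j + 1) 0) ≤ (4 * T) ^ T * c3c ξ η ^ T * plen P := by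
    intro j hj
    have hjT := Finset.mem_range.mp hj
    have h1 := norm_eval_le (isHomogeneous_newtonOp (t := fun i => (K : ℂ) - s i) hP j) hβ
    have h2 := plen_newtonOp_le hP ht (Nat.cast_nonneg T) hjT.le
    have h3 := plen_dividedExp_le ξ η hblock hK (j + 1) 0 (by lia)
    have hkT : (k : ℝ) + T ≤ 2 * T := by
      have : (k : ℝ) ≤ T := by exact_mod_cast hk
      linarith
    calc _ ≤ ‖eval ![1, ξ, η] (newtonOp (fun i => (K : ℂ) - s i) j P)‖ *
          plen (dividedExp ξ η K s (j + 1) 0) := plen_C_mul_le _ _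
      _ ≤ (c2c ξ η ^ k * ((k + T) ^ j * plen P)) *
          (2 ^ (j + 1) * (2 + ‖ξ‖ + ‖η‖⁻¹) ^ K) := by
          refine mul_le_mul (h1.trans ?_) h3 (plen_nonneg _) ?_
          · gcongr
          · have := plen_nonneg P
            positivity
      _ ≤ (c2c ξ η ^ T * ((2 * T) ^ T * plen P)) * (2 ^ T * (2 + ‖ξ‖ + ‖η‖⁻¹) ^ T) := by
          have := plen_nonneg P
          have e : ((k : ℝ) + T) ^ j ≤ (2 * T) ^ T :=
            (pow_le_pow_left₀ (by positivity) hkT j).trans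
              (pow_le_pow_right₀ (by linarith) hjT.le)
          gcongr
          · exact one_le_two
          · lia
          · linarith
      _ = _ := by
          rw [c3c, show (4 * (T : ℝ)) = 2 * T * 2 by ring]
          simp only [mul_pow]
          ring
  rw [jetReduction_apply]
  refine (plen_sum_le _ _).trans ((Finset.sum_le_card_nsmul _ _ _ hterm).trans_eq ?_)
  rw [Finset.card_range, nsmul_eq_mul]
  ring

variable (hmono : Monotone s)

include hmono

theorem sub_jetReduction_mem_Igam (hη : η ≠ 0) {k : ℕ} (hk : K ≤ k)
    {P : MvPolynomial (Fin 3) ℂ} (hP : P.IsHomogeneous k) :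
    P - X 0 ^ (k - K) * jetReduction ξ η K s T P ∈ Igam ξ η T := by
  have h := (isHomogeneous_X_pow (R := ℂ) (0 : Fin 3) (k - K)).mul
    (isHomogeneous_jetReduction ξ η hblock hK P)
  rw [Nat.sub_add_cancel hk] at h
  refine mem_Igam_of_newtonOp (t := fun i => (K : ℂ) - s i) (hP.sub h) fun j hj => ?_
  rw [map_sub, newtonOp_X_zero_pow_mul, jetReduction_apply, map_sum]
  simp only [← smul_eq_C_mul, map_smul]
  simp only [smul_eq_C_mul, map_sub, map_mul, map_sum, eval_C]
  rw [Finset.sum_congr rfl fun k hk => by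
    rw [eval_newtonOp_dividedExp ξ η hblock hK hmono hη (Finset.mem_range.mp hk)]]
  simp [hj]

end Reduction

section Isup

variable {ξ η : ℂ} {T D : ℕ} {α : Fin 3 → ℂ}

theorem Isup_nonneg : 0 ≤ Isup ξ η T D α :=
  Real.sSup_nonneg (by rintro _ ⟨P, -, -, -, rfl⟩; exact norm_nonneg _)

variable (hα : ∀ i, ‖α i‖ ≤ 1)

include hα

theorem bddAbove_Isup : BddAbove {x : ℝ | ∃ P : MvPolynomial (Fin 3) ℂ,
    P ∈ Igam ξ η T ∧ P.IsHomogeneous D ∧ pnorm P ≤ 1 ∧ x = ‖eval α P‖} := by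
  refine ⟨(Finset.Iic (Finsupp.equivFunOnFinite.symm fun _ : Fin 3 => D)).card, ?_⟩
  rintro _ ⟨P, -, hP, h1, rfl⟩
  have h2 := norm_eval_le hP hα
  rw [one_pow, one_mul] at h2
  refine (h2.trans (plen_le_of_isHomogeneous hP)).trans ?_
  exact mul_le_of_le_one_right (Nat.cast_nonneg _) h1

theorem norm_eval_le_Isup {P : MvPolynomial (Fin 3) ℂ} (hP : P ∈ Igam ξ η T)
    (hPh : P.IsHomogeneous D) : ‖eval α P‖ ≤ pnorm P * Isup ξ η T D α := by
  have h0 : 0 ≤ pnorm P := NNReal.coe_nonneg _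
  rcases h0.eq_or_lt with h | h
  · have h1 := norm_eval_le hPh hα
    have h2 := plen_le_of_isHomogeneous hPh
    rw [← h, mul_zero] at h2
    rw [← h, zero_mul]
    rw [one_pow, one_mul] at h1
    exact h1.trans h2
  · have hn : ‖((pnorm P : ℂ))⁻¹‖ = (pnorm P)⁻¹ := by
      rw [norm_inv, Complex.norm_real, Real.norm_of_nonneg h0]
    have hle : ‖eval α (C (pnorm P : ℂ)⁻¹ * P)‖ ≤ Isup ξ η T D α := by
      refine le_csSup (bddAbove_Isup hα) ⟨_, Ideal.mul_mem_left _ _ hP, ?_, ?_, rfl⟩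
      · simpa using (isHomogeneous_C (Fin 3) ((pnorm P : ℂ)⁻¹)).mul hPh
      · refine (pnorm_C_mul_le _ _).trans_eq ?_
        rw [hn, inv_mul_cancel₀ h.ne']
    rw [map_mul, eval_C, norm_mul, hn, inv_mul_le_iff₀ h] at hle
    exact hle

end Isup

section Descent

variable {ξ η : ℂ} (hη : η ≠ 0) {K : ℕ} {s : ℕ → ℕ} {T D : ℕ}
  (hblock : ∀ i n, s (i + n) = s i → n ≤ s i) (hK : ∀ i < T, s i ≤ K) (hmono : Monotone s)
  {α : Fin 3 → ℂ} (hα : ∀ i, ‖α i‖ ≤ 1)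

include hη hblock hK hmono hα

theorem norm_eval_X_mul_jetReduction_sub_le (hKD : K < D) {b : ℝ} {i : Fin 3} {k : ℕ}
    (hk : D ≤ k) {P : MvPolynomial (Fin 3) ℂ} (hP : P.IsHomogeneous k)
    (h1 : plen (jetReduction ξ η K s T P) ≤ b)
    (h2 : plen (jetReduction ξ η K s T (X i * P)) ≤ b) :
    ‖eval α (X i * jetReduction ξ η K s T P - X 0 * jetReduction ξ η K s T (X i * P))‖ *
      ‖α 0‖ ^ (k - K) ≤ 2 * b * Isup ξ η T D α := by
  set R := jetReduction ξ η K s T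
  set W := X i * R P - X 0 * R (X i * P) with hW
  have hPi : (X i * P).IsHomogeneous (k + 1) := by
    have := (isHomogeneous_X ℂ i).mul hP
    rwa [add_comm] at this
  have hWh : W.IsHomogeneous (K + 1) := by
    have e1 := (isHomogeneous_X ℂ i).mul (isHomogeneous_jetReduction ξ η hblock hK P)
    have e2 := (isHomogeneous_X ℂ (0 : Fin 3)).mul
      (isHomogeneous_jetReduction ξ η hblock hK (X i * P))
    rw [add_comm] at e1 e2
    exact e1.sub e2
  have hmem : X 0 ^ (k - K) * W ∈ Igam ξ η T := by
    have e1 := Ideal.mul_mem_left _ (X i)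
      (sub_jetReduction_mem_Igam ξ η hblock hK hmono hη (by lia : K ≤ k) hP)
    have e2 := sub_jetReduction_mem_Igam ξ η hblock hK hmono hη (by lia : K ≤ k + 1) hPi
    have e3 := Ideal.sub_mem _ e2 e1
    rw [show k + 1 - K = k - K + 1 by lia] at e3
    convert e3 using 1
    rw [hW]
    ring
  have hWmem : W ∈ Igam ξ η T := by
    refine mem_Igam_of_newtonOp (t := fun _ => 0) hWh fun j hj => ?_
    have := eval_newtonOp_of_mem_Igam (t := fun _ => 0) hmem hj
    rw [newtonOp_X_zero_pow_mul, map_mul] at this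
    simpa using this
  have hXh : (X 0 ^ (D - (K + 1)) * W).IsHomogeneous D := by
    have := (isHomogeneous_X_pow (R := ℂ) (0 : Fin 3) (D - (K + 1))).mul hWh
    rwa [Nat.sub_add_cancel hKD] at this
  have hpl : pnorm (X 0 ^ (D - (K + 1)) * W) ≤ 2 * b := by
    refine (pnorm_le_plen _).trans ((plen_X_pow_mul_le _ _ _).trans ?_)
    have := plen_sub_le (X i * R P) (X 0 * R (X i * P))
    have := plen_X_mul_le (R P) i
    have := plen_X_mul_le (R (X i * P)) 0
    linarith
  have hle := norm_eval_le_Isup hα (Ideal.mul_mem_left _ _ hWmem) hXh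
  rw [map_mul, map_pow, eval_X, norm_mul, norm_pow] at hle
  calc ‖eval α W‖ * ‖α 0‖ ^ (k - K)
      ≤ ‖eval α W‖ * ‖α 0‖ ^ (D - (K + 1)) :=
        mul_le_mul_of_nonneg_left
          (pow_le_pow_of_le_one (norm_nonneg _) (hα 0) (by lia)) (norm_nonneg _)
    _ = ‖α 0‖ ^ (D - (K + 1)) * ‖eval α W‖ := mul_comm _ _
    _ ≤ _ := hle.trans (mul_le_mul_of_nonneg_right hpl Isup_nonneg)

theorem norm_eval_monomial_sub_le (hKD : K < D) {b : ℝ} (hb : 1 ≤ b)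
    (hR : ∀ v : Fin 3 →₀ ℕ, v.degree ≤ T → plen (jetReduction ξ η K s T (monomial v 1)) ≤ b)
    {k : ℕ} (hDk : D ≤ k) : k ≤ T → ∀ v : Fin 3 →₀ ℕ, v.degree = k →
      ‖eval α (monomial v 1 - X 0 ^ (k - K) * jetReduction ξ η K s T (monomial v 1))‖ ≤
        (k - D + 1) * (2 * b * Isup ξ η T D α) := by
  induction k, hDk using Nat.le_induction with
  | base =>
    intro hDT v hv
    have hh := isHomogeneous_monomial (R := ℂ) 1 hv
    have hXh := (isHomogeneous_X_pow (R := ℂ) (0 : Fin 3) (D - K)).mul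
      (isHomogeneous_jetReduction ξ η hblock hK (monomial v 1))
    rw [Nat.sub_add_cancel hKD.le] at hXh
    have := norm_eval_le_Isup hα
      (sub_jetReduction_mem_Igam ξ η hblock hK hmono hη hKD.le hh) (hh.sub hXh)
    rw [sub_self, zero_add, one_mul]
    refine this.trans (mul_le_mul_of_nonneg_right ?_ Isup_nonneg)
    refine (pnorm_le_plen _).trans ((plen_sub_le _ _).trans ?_)
    have h1 := hR v (by lia)
    have h2 := plen_X_pow_mul_le (jetReduction ξ η K s T (monomial v 1)) 0 (D - K)
    rw [plen_monomial, norm_one]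
    linarith
  | succ k hDk ih =>
    intro hkT v hv
    have hv0 : v ≠ 0 := by rintro rfl; simp at hv
    obtain ⟨i, hi⟩ := Finsupp.ne_iff.mp hv0
    have hsplit : Finsupp.single i 1 + (v - Finsupp.single i 1) = v :=
      add_tsub_cancel_of_le (Finsupp.single_le_iff.mpr (Nat.one_le_iff_ne_zero.mpr hi))
    set w := v - Finsupp.single i 1 with hw
    have hwd : w.degree = k := by
      have := congrArg Finsupp.degree hsplit
      rw [map_add, Finsupp.degree_single, hv] at this
      lia
    have hmon : monomial v (1 : ℂ) = X i * monomial w 1 := by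
      rw [X, monomial_mul, hsplit, one_mul]
    have hstep := norm_eval_X_mul_jetReduction_sub_le hη hblock hK hmono hα hKD (i := i) hDk
      (isHomogeneous_monomial (R := ℂ) 1 hwd) (hR w (by lia))
      (by rw [← hmon]; exact hR v (by lia))
    rw [← hmon] at hstep
    have ih := ih (by lia) w hwd
    set R := jetReduction ξ η K s T
    have e : (monomial v 1 - X 0 ^ (k + 1 - K) * R (monomial v 1) : MvPolynomial (Fin 3) ℂ) =
        X i * (monomial w 1 - X 0 ^ (k - K) * R (monomial w 1)) +
          (X i * R (monomial w 1) - X 0 * R (monomial v 1)) * X 0 ^ (k - K) := by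
      rw [show k + 1 - K = k - K + 1 by lia]
      nth_rewrite 1 [hmon]
      ring
    rw [e, map_add, map_mul, map_mul _ _ (X 0 ^ (k - K)), map_pow, eval_X, eval_X]
    refine (norm_add_le _ _).trans ?_
    rw [norm_mul, norm_mul, norm_pow]
    have h1 := mul_le_of_le_one_left (norm_nonneg
      (eval α (monomial w 1 - X 0 ^ (k - K) * R (monomial w 1)))) (hα i)
    push_cast
    linarith

theorem norm_eval_le_of_mem_Igam (hKD : K < D) {b : ℝ} (hb : 1 ≤ b)
    (hR : ∀ v : Fin 3 →₀ ℕ, v.degree ≤ T → plen (jetReduction ξ η K s T (monomial v 1)) ≤ b)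
    {k : ℕ} (hDk : D ≤ k) (hkT : k ≤ T) {Q : MvPolynomial (Fin 3) ℂ} (hQ : Q ∈ Igam ξ η T)
    (hQh : Q.IsHomogeneous k) :
    ‖eval α Q‖ ≤ plen Q * ((k - D + 1) * (2 * b * Isup ξ η T D α)) := by
  have hred : Q = Q - X 0 ^ (k - K) * jetReduction ξ η K s T Q := by
    rw [jetReduction_of_mem_Igam ξ η hQ, mul_zero, sub_zero]
  have hsum : Q = ∑ v ∈ Q.support, C (Q.coeff v) *
      (monomial v 1 - X 0 ^ (k - K) * jetReduction ξ η K s T (monomial v 1)) := by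
    have hQs : Q = ∑ v ∈ Q.support, Q.coeff v • monomial v (1 : ℂ) := by
      conv_lhs => rw [Q.as_sum]
      simp [smul_monomial]
    conv_lhs => rw [hred]
    nth_rewrite 2 [hQs]
    nth_rewrite 1 [hQs]
    rw [map_sum, Finset.mul_sum, ← Finset.sum_sub_distrib]
    refine Finset.sum_congr rfl fun v _ => ?_
    rw [map_smul, smul_eq_C_mul, smul_eq_C_mul]
    ring
  conv_lhs => rw [hsum]
  rw [map_sum, plen, Finset.sum_mul]
  refine norm_sum_le_of_le _ fun v hv => ?_
  rw [map_mul, eval_C, norm_mul]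
  exact mul_le_mul_of_nonneg_left (norm_eval_monomial_sub_le hη hblock hK hmono hα hKD hb hR hDk
    hkT v (hQh.degree_eq_of_mem_support hv)) (norm_nonneg _)

end Descent

theorem two_mul_sq_mul_pow_le_rpow {T : ℕ} (hT : 4 ≤ T) :
    (T : ℝ) * (2 * (T * (4 * T) ^ T)) ≤ (T : ℝ) ^ (6 * (T : ℝ) * Real.log T) := by
  have hT4 : (4 : ℝ) ≤ T := by exact_mod_cast hT
  have hlog : 1 ≤ Real.log T := by
    rw [Real.le_log_iff_exp_le (by linarith)]
    linarith [Real.exp_one_lt_d9]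
  calc (T : ℝ) * (2 * (T * (4 * T) ^ T))
      ≤ T * (T * (T * (T * T) ^ T)) := by gcongr; linarith
    _ = (T : ℝ) ^ (3 + 2 * T) := by ring
    _ ≤ (T : ℝ) ^ (6 * T) := pow_le_pow_right₀ (by linarith) (by lia)
    _ = (T : ℝ) ^ (6 * (T : ℝ)) := by rw [← Real.rpow_natCast]; push_cast; rfl
    _ ≤ _ := Real.rpow_le_rpow_of_exponent_le (by linarith)
        (le_mul_of_one_le_right (by positivity) hlog)

theorem stmt12 (ξ η : ℂ) (hη : η ≠ 0) (D T : ℕ) (hD : 3 ≤ D) (hDT : D ≤ T)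
    (hT2 : T ≤ Nat.choose (D / 3 + 1) 2)
    (α : Fin 3 → ℂ) (hα : max ‖α 0‖ (max ‖α 1‖ ‖α 2‖) = 1)
    (Q : MvPolynomial (Fin 3) ℂ) (hQ : Q ∈ Igam ξ η T) (hQh : Q.IsHomogeneous T) :
    ‖eval α Q‖ ≤
      c3c ξ η ^ (2 * T) * (T : ℝ) ^ (6 * (T : ℝ) * Real.log T) * plen Q *
        Isup ξ η T D α := by
  have hα1 : ∀ i, ‖α i‖ ≤ 1 := by
    intro i
    fin_cases i
    · exact hα ▸ le_max_left _ _
    · exact hα ▸ (le_max_left _ _).trans (le_max_right _ _)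
    · exact hα ▸ (le_max_right _ _).trans (le_max_right _ _)
  have hT4 : 4 ≤ T := by
    by_contra! hc
    obtain rfl : T = 3 := by lia
    obtain rfl : D = 3 := by lia
    exact absurd hT2 (by decide)
  obtain ⟨s, hmono, hblock, hbound⟩ := exists_triangular_blocks
  obtain ⟨K, hKeq⟩ : ∃ K, D / 3 = K + 1 := ⟨D / 3 - 1, by lia⟩
  have hK : ∀ i < T, s i ≤ K := fun i hi => by
    have := hbound (D / 3) i (hi.trans_le hT2)
    lia
  have hKD : K < D := by lia
  have hη' : 0 ≤ ‖η‖⁻¹ := inv_nonneg.mpr (norm_nonneg _)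
  have hξ' : 0 ≤ ‖ξ‖ := norm_nonneg _
  have hc3 : 1 ≤ c3c ξ η :=
    one_le_mul_of_one_le_of_one_le (by linarith) (le_max_left _ _)
  have hT1 : (4 : ℝ) ≤ T := by exact_mod_cast hT4
  have hD3 : (3 : ℝ) ≤ D := by exact_mod_cast hD
  have hb : 1 ≤ T * (4 * T) ^ T * c3c ξ η ^ T :=
    one_le_mul_of_one_le_of_one_le (one_le_mul_of_one_le_of_one_le (by linarith)
      (one_le_pow₀ (by linarith))) (one_le_pow₀ hc3)
  have hmain := norm_eval_le_of_mem_Igam hη hblock hK hmono hα1 hKD hb (fun v hv => by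
    have := plen_jetReduction_le ξ η hblock hK (by lia) hv
      (isHomogeneous_monomial (R := ℂ) 1 rfl)
    rwa [plen_monomial, norm_one, mul_one] at this) hDT le_rfl hQ hQh
  have hI : 0 ≤ Isup ξ η T D α := Isup_nonneg
  have hQ0 := plen_nonneg Q
  calc ‖eval α Q‖
      ≤ plen Q * ((T - D + 1) * (2 * (T * (4 * T) ^ T * c3c ξ η ^ T) * Isup ξ η T D α)) := hmain
    _ ≤ plen Q * (T * (2 * (T * (4 * T) ^ T * c3c ξ η ^ T) * Isup ξ η T D α)) := by
        gcongr
        linarith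
    _ = c3c ξ η ^ T * (T * (2 * (T * (4 * T) ^ T))) * plen Q * Isup ξ η T D α := by ring
    _ ≤ _ := by
        gcongr ?_ * ?_ * _ * _
        · exact pow_le_pow_right₀ hc3 (by lia)
        · exact two_mul_sq_mul_pow_le_rpow hT4
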